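/- Let r ≥ 2 and let P be a hereditary property of r-graphs containing graphs of arbitrarily large order. Then λ^(α)(P) is nonincreasing in α on [1,∞): for all 1 ≤ α ≤ β, λ^(β)(P) ≤ λ^(α)(P). -/

import Mathlib

/-!
Common definitions: `r`-uniform hypergraphs on vertex set `Fin n`, the polyform,
the parameter `λ^(α)`, degrees, properties of `r`-graphs, blow-ups, extremal
numbers and chromatic numbers.
-/

open Finset

/-- An `r`-uniform hypergraph on the vertex set `Fin n`. -/
structure HGraph (r n : ℕ) where
  edges : Finset (Finset (Fin n))
  uniform : ∀ e ∈ edges, e.card = r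

namespace HGraph

/-- The polyform `P_G(x) = r! ∑_{e ∈ E(G)} ∏_{i ∈ e} x_i`. -/
noncomputable def polyform {r n : ℕ} (G : HGraph r n) (x : Fin n → ℝ) : ℝ :=
  (r.factorial : ℝ) * ∑ e ∈ G.edges, ∏ i ∈ e, x i

/-- `λ^(α)(G)`: the maximum of the polyform over the unit sphere of `ℓ^α`. -/
noncomputable def lam {r n : ℕ} (α : ℝ) (G : HGraph r n) : ℝ :=
  sSup {y : ℝ | ∃ x : Fin n → ℝ, (∑ i, |x i| ^ α) = 1 ∧ y = G.polyform x}

/-- The degree of a vertex: the number of edges containing it. -/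
def degree {r n : ℕ} (G : HGraph r n) (v : Fin n) : ℕ :=
  (G.edges.filter (fun e => v ∈ e)).card

/-- Maximum degree `Δ(G)`. -/
def maxDeg {r n : ℕ} (G : HGraph r n) : ℕ :=
  Finset.univ.sup G.degree

/-- Minimum degree `δ(G)`. -/
noncomputable def minDeg {r n : ℕ} (G : HGraph r n) : ℕ :=
  sInf (Set.range G.degree)

/-- `G` is regular if all vertices have equal degrees. -/
def Regular {r n : ℕ} (G : HGraph r n) : Prop :=
  ∀ u v : Fin n, G.degree u = G.degree v

/-- The induced subgraph of `G` along the embedding `f`. -/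
def induce {r n m : ℕ} (G : HGraph r n) (f : Fin m ↪ Fin n) : HGraph r m where
  edges := Finset.univ.filter (fun e : Finset (Fin m) => e.map f ∈ G.edges)
  uniform := by
    intro e he
    rw [Finset.mem_filter] at he
    have h2 := G.uniform _ he.2
    rwa [Finset.card_map] at h2

/-- A property of `r`-graphs: a family closed under isomorphism (relabeling). -/
def IsProperty {r : ℕ} (P : ∀ n, Set (HGraph r n)) : Prop :=
  ∀ n : ℕ, ∀ σ : Equiv.Perm (Fin n), ∀ G ∈ P n, G.induce σ.toEmbedding ∈ P n

/-- A hereditary property: closed under taking induced subgraphs. -/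
def Hereditary {r : ℕ} (P : ∀ n, Set (HGraph r n)) : Prop :=
  ∀ n m : ℕ, ∀ f : Fin m ↪ Fin n, ∀ G ∈ P n, G.induce f ∈ P m

/-- A monotone property: closed under taking subgraphs. -/
def MonotoneProp {r : ℕ} (P : ∀ n, Set (HGraph r n)) : Prop :=
  ∀ n m : ℕ, ∀ f : Fin m ↪ Fin n, ∀ G ∈ P n, ∀ H : HGraph r m,
    (∀ e ∈ H.edges, e.map f ∈ G.edges) → H ∈ P m

/-- `B`, together with the projection `φ : V(B) → V(G)`, is (a copy of) the blow-up
`G(k 1, …, k n)` of `G`: the fiber over a vertex `i` of `G` has `k i` vertices, and the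
edges of `B` are exactly the transversals of the classes corresponding to edges of `G`. -/
def IsBlowup {r n N : ℕ} (G : HGraph r n) (k : Fin n → ℕ)
    (B : HGraph r N) (φ : Fin N → Fin n) : Prop :=
  (∀ i : Fin n, (Finset.univ.filter (fun v => φ v = i)).card = k i) ∧
  ∀ s : Finset (Fin N), s ∈ B.edges ↔ (Set.InjOn φ ↑s ∧ s.image φ ∈ G.edges)

/-- A multiplicative property: contains all blow-ups of all of its members. -/
def MultiplicativeProp {r : ℕ} (P : ∀ n, Set (HGraph r n)) : Prop :=
  ∀ n : ℕ, ∀ G ∈ P n, ∀ k : Fin n → ℕ, (∀ i, 0 < k i) →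
    ∀ N : ℕ, ∀ B : HGraph r N, ∀ φ : Fin N → Fin n, IsBlowup G k B φ → B ∈ P N

/-- The extremal number `ex(P, n)`: the maximum number of edges of a member of `P`
of order `n`. -/
noncomputable def exP {r : ℕ} (P : ∀ n, Set (HGraph r n)) (n : ℕ) : ℕ :=
  sSup {m : ℕ | ∃ G ∈ P n, G.edges.card = m}

/-- `λ^(α)(P, n)`: the maximum of `λ^(α)(G)` over members `G` of `P` of order `n`. -/
noncomputable def lamP {r : ℕ} (α : ℝ) (P : ∀ n, Set (HGraph r n)) (n : ℕ) : ℝ :=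
  sSup {y : ℝ | ∃ G ∈ P n, y = lam α G}

/-- The chromatic number: the least `k` such that the vertices can be `k`-colored
with no monochromatic edge (i.e. partitioned into `k` edgeless sets). -/
noncomputable def chrom {r n : ℕ} (G : HGraph r n) : ℕ :=
  sInf {k : ℕ | ∃ c : Fin n → Fin k, ∀ e ∈ G.edges, ¬ ∀ u ∈ e, ∀ w ∈ e, c u = c w}

/-- The weak chromatic number: the least `k` such that the vertices can be `k`-colored
with every edge getting `r` distinct colors (every class meets every edge in ≤ 1 vertex). -/
noncomputable def wchrom {r n : ℕ} (G : HGraph r n) : ℕ :=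
  sInf {k : ℕ | ∃ c : Fin n → Fin k, ∀ e ∈ G.edges, Set.InjOn c ↑e}

/-- `Mon(H)`: the (monotone, hereditary) property of all `r`-graphs containing no
subgraph isomorphic to `H`. -/
def MonP {r h : ℕ} (H : HGraph r h) : ∀ n, Set (HGraph r n) :=
  fun n => {G | ¬ ∃ f : Fin h ↪ Fin n, ∀ e ∈ H.edges, e.map f ∈ G.edges}

end HGraph

open HGraph

namespace HGraph

instance {r n : ℕ} : Finite (HGraph r n) :=
  Finite.of_injective HGraph.edges (by
    rintro ⟨e, he⟩ ⟨f, hf⟩ h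
    cases h
    rfl)

variable {r n : ℕ}

theorem continuous_polyform (G : HGraph r n) : Continuous G.polyform := by
  unfold polyform
  fun_prop

theorem polyform_nonneg (G : HGraph r n) {x : Fin n → ℝ} (hx : ∀ i, 0 ≤ x i) :
    0 ≤ G.polyform x :=
  mul_nonneg (Nat.cast_nonneg _)
    (Finset.sum_nonneg fun _ _ => Finset.prod_nonneg fun i _ => hx i)

theorem polyform_le_polyform_abs (G : HGraph r n) (x : Fin n → ℝ) :
    G.polyform x ≤ G.polyform (fun i => |x i|) := by
  refine mul_le_mul_of_nonneg_left (Finset.sum_le_sum fun e _ => ?_) (Nat.cast_nonneg _)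
  exact (le_abs_self _).trans_eq (Finset.abs_prod e x)

theorem polyform_smul (G : HGraph r n) (c : ℝ) (x : Fin n → ℝ) :
    G.polyform (fun i => c * x i) = c ^ r * G.polyform x := by
  unfold polyform
  rw [mul_left_comm, Finset.mul_sum _ _ (c ^ r)]
  congr 1
  refine Finset.sum_congr rfl fun e he => ?_
  rw [Finset.prod_mul_distrib, Finset.prod_const, G.uniform e he]

/-- The polyform is affine in each coordinate. -/
theorem polyform_update_mul (G : HGraph r n) (x : Fin n → ℝ) (k : Fin n) (c : ℝ) :
    G.polyform (Function.update x k (c * x k)) =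
      G.polyform (Function.update x k 0) +
        c * (G.polyform x - G.polyform (Function.update x k 0)) := by
  have key : ∀ e : Finset (Fin n), ∏ i ∈ e, Function.update x k (c * x k) i =
      ∏ i ∈ e, Function.update x k 0 i +
        c * (∏ i ∈ e, x i - ∏ i ∈ e, Function.update x k 0 i) := by
    intro e
    by_cases hk : k ∈ e
    · rw [Finset.prod_update_of_mem hk, Finset.prod_update_of_mem hk,
        ← Finset.mul_prod_erase e x hk, Finset.sdiff_singleton_eq_erase]
      ring
    · rw [Finset.prod_update_of_notMem hk, Finset.prod_update_of_notMem hk]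
      ring
  unfold polyform
  rw [Finset.sum_congr (s₁ := G.edges) rfl fun e _ => key e, Finset.sum_add_distrib, ← Finset.mul_sum,
    Finset.sum_sub_distrib]
  ring

theorem polyform_induce_succAbove (G : HGraph r (n + 1)) (x : Fin (n + 1) → ℝ)
    (k : Fin (n + 1)) :
    (G.induce k.succAboveEmb).polyform (fun i => x (k.succAbove i)) =
      G.polyform (Function.update x k 0) := by
  unfold polyform
  congr 1
  have hsub : (G.edges.filter fun e => k ∉ e) ⊆ G.edges := Finset.filter_subset _ _
  rw [← Finset.sum_subset hsub]
  · refine Finset.sum_bij (fun e _ => e.map k.succAboveEmb) ?_ ?_ ?_ ?_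
    · intro e he
      simp only [induce, Finset.mem_filter, Finset.mem_univ, true_and] at he
      refine Finset.mem_filter.2 ⟨he, ?_⟩
      simp [Fin.succAbove_ne]
    · intro a _ b _ h
      exact Finset.map_injective _ h
    · intro e he
      rw [Finset.mem_filter] at he
      have h : (e.preimage k.succAbove
          (Fin.succAbove_right_injective.injOn)).map k.succAboveEmb = e := by
        ext i
        simp only [Finset.mem_map, Finset.mem_preimage, Fin.coe_succAboveEmb]
        constructor
        · rintro ⟨j, hj, rfl⟩
          exact hj
        · intro hi
          have hik : i ≠ k := fun h => he.2 (h ▸ hi)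
          obtain ⟨j, rfl⟩ := Fin.exists_succAbove_eq hik
          exact ⟨j, hi, rfl⟩
      refine ⟨_, ?_, h⟩
      simp only [induce, Finset.mem_filter, Finset.mem_univ, true_and]
      rw [h]
      exact he.1
    · intro e _
      rw [Finset.prod_map]
      refine Finset.prod_congr rfl fun i _ => ?_
      simp
  · intro e he hke
    have hk : k ∈ e := by
      by_contra h
      exact hke (Finset.mem_filter.2 ⟨he, h⟩)
    rw [Finset.prod_update_of_mem hk, zero_mul]

theorem isCompact_sum_abs_rpow_eq_one {α : ℝ} (hα : 0 < α) :
    IsCompact {x : Fin n → ℝ | ∑ i, |x i| ^ α = 1} := by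
  refine Metric.isCompact_of_isClosed_isBounded ?_ ?_
  · refine isClosed_eq (continuous_finsetSum _ fun i _ => ?_) continuous_const
    exact (continuous_apply i).abs.rpow_const fun _ => Or.inr hα.le
  · refine (Metric.isBounded_closedBall (x := (0 : Fin n → ℝ)) (r := 1)).subset ?_
    intro x hx
    rw [mem_closedBall_zero_iff, pi_norm_le_iff_of_nonneg zero_le_one]
    intro i
    rw [Real.norm_eq_abs]
    by_contra! h
    have h1 : 1 < |x i| ^ α := Real.one_lt_rpow h hα
    have h2 : |x i| ^ α ≤ ∑ j, |x j| ^ α :=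
      Finset.single_le_sum (f := fun j => |x j| ^ α)
        (fun j _ => Real.rpow_nonneg (abs_nonneg _) _) (Finset.mem_univ i)
    have h3 : ∑ j, |x j| ^ α = 1 := hx
    linarith

theorem polyform_le_lam (G : HGraph r n) {α : ℝ} (hα : 0 < α) {x : Fin n → ℝ}
    (hx : ∑ i, |x i| ^ α = 1) : G.polyform x ≤ lam α G := by
  have hbdd := ((isCompact_sum_abs_rpow_eq_one (n := n) hα).image
    G.continuous_polyform).bddAbove
  refine le_csSup (hbdd.mono ?_) ⟨x, hx, rfl⟩
  rintro _ ⟨y, hy, rfl⟩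
  exact ⟨y, hy, rfl⟩

theorem exists_nonneg_polyform_eq_lam (G : HGraph r (n + 1)) {α : ℝ} (hα : 0 < α) :
    ∃ x : Fin (n + 1) → ℝ, (∀ i, 0 ≤ x i) ∧ ∑ i, x i ^ α = 1 ∧ G.polyform x = lam α G := by
  have hne : {x : Fin (n + 1) → ℝ | ∑ i, |x i| ^ α = 1}.Nonempty := by
    refine ⟨Pi.single 0 1, ?_⟩
    rw [Set.mem_ofPred_eq, Finset.sum_eq_single 0]
    · simp
    · intro i _ hi
      simp [hi, Real.zero_rpow hα.ne']
    · simp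
  obtain ⟨x, hx, hmax⟩ := (isCompact_sum_abs_rpow_eq_one hα).exists_isMaxOn hne
    G.continuous_polyform.continuousOn
  have hx' : ∑ i, |x i| ^ α = 1 := hx
  refine ⟨fun i => |x i|, fun i => abs_nonneg _, hx', le_antisymm ?_ ?_⟩
  · exact G.polyform_le_lam hα (by simpa using hx')
  · refine le_trans (csSup_le ⟨_, x, hx', rfl⟩ ?_) (G.polyform_le_polyform_abs x)
    rintro _ ⟨y, hy, rfl⟩
    exact hmax hy

theorem lam_nonneg (G : HGraph r (n + 1)) {α : ℝ} (hα : 0 < α) : 0 ≤ lam α G := by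
  obtain ⟨x, hx, -, h⟩ := G.exists_nonneg_polyform_eq_lam hα
  exact h ▸ G.polyform_nonneg hx

/-- The homogeneous form of the definition of `lam`. -/
theorem polyform_le_lam_mul (G : HGraph r n) (hr : r ≠ 0) {α : ℝ} (hα : 0 < α)
    {x : Fin n → ℝ} (hx : ∀ i, 0 ≤ x i) :
    G.polyform x ≤ lam α G * (∑ i, x i ^ α) ^ ((r : ℝ) / α) := by
  have hs0 : 0 ≤ ∑ i, x i ^ α := Finset.sum_nonneg fun i _ => Real.rpow_nonneg (hx i) _
  have hr' : (r : ℝ) ≠ 0 := Nat.cast_ne_zero.2 hr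
  rcases hs0.eq_or_lt with hs | hs
  · rw [← hs, Real.zero_rpow (div_ne_zero hr' hα.ne'), mul_zero]
    have hx0 : x = fun i => 0 * x i := by
      funext i
      have := (Finset.sum_eq_zero_iff_of_nonneg
        fun i _ => Real.rpow_nonneg (hx i) α).1 hs.symm i (Finset.mem_univ i)
      rw [(Real.rpow_eq_zero (hx i) hα.ne').1 this, mul_zero]
    rw [hx0, polyform_smul, zero_pow hr, zero_mul]
  · set s := ∑ i, x i ^ α with hsdef
    set c := s ^ (α⁻¹) with hc
    have hcpos : 0 < c := Real.rpow_pos_of_pos hs _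
    have hcα : c ^ α = s := by
      rw [hc, ← Real.rpow_mul hs.le, inv_mul_cancel₀ hα.ne', Real.rpow_one]
    have hcr : c ^ r = s ^ ((r : ℝ) / α) := by
      rw [hc, ← Real.rpow_natCast, ← Real.rpow_mul hs.le, inv_mul_eq_div]
    have hsum : ∑ i, |c⁻¹ * x i| ^ α = 1 := by
      have : ∀ i, |c⁻¹ * x i| ^ α = s⁻¹ * x i ^ α := by
        intro i
        have hci : 0 ≤ c⁻¹ := (inv_pos.2 hcpos).le
        rw [abs_of_nonneg (mul_nonneg hci (hx i)), Real.mul_rpow hci (hx i),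
          Real.inv_rpow hcpos.le, hcα]
      rw [Finset.sum_congr rfl fun i _ => this i, ← Finset.mul_sum, ← hsdef,
        inv_mul_cancel₀ hs.ne']
    have h := G.polyform_le_lam hα hsum
    rw [polyform_smul, inv_pow, inv_mul_le_iff₀ (pow_pos hcpos r), hcr] at h
    linarith

/-- The Lagrange condition, in terms of deleting a vertex from an optimal vector. -/
theorem polyform_update_zero_eq (G : HGraph r n) (hr : r ≠ 0) {α : ℝ} (hα : 1 ≤ α)
    {x : Fin n → ℝ} (hx : ∀ i, 0 ≤ x i) (hsum : ∑ i, x i ^ α = 1)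
    (hmax : G.polyform x = lam α G) (k : Fin n) :
    G.polyform (Function.update x k 0) = lam α G * (1 - r * x k ^ α) := by
  have hα0 : 0 < α := by linarith
  set t := x k ^ α with ht
  set D := G.polyform x - G.polyform (Function.update x k 0) with hD
  have hnonneg : ∀ c : ℝ, 0 ≤ c →
      G.polyform x - D + c * D ≤ lam α G * (1 - t + c ^ α * t) ^ ((r : ℝ) / α) := by
    intro c hc
    have hy : ∀ i, 0 ≤ Function.update x k (c * x k) i := by
      intro i
      by_cases hik : i = k
      · subst hik
        simpa using mul_nonneg hc (hx i)
      · simpa [hik] using hx i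
    have h := G.polyform_le_lam_mul hr hα0 hy
    have hs : ∑ i, Function.update x k (c * x k) i ^ α = 1 - t + c ^ α * t := by
      rw [← Finset.add_sum_erase _ _ (Finset.mem_univ k)] at hsum ⊢
      rw [Function.update_self, Real.mul_rpow hc (hx k), ← ht]
      have : ∑ i ∈ Finset.univ.erase k, Function.update x k (c * x k) i ^ α =
          ∑ i ∈ Finset.univ.erase k, x i ^ α :=
        Finset.sum_congr rfl fun i hi => by
          rw [Function.update_of_ne (Finset.ne_of_mem_erase hi)]
      rw [this]
      linarith
    rw [polyform_update_mul, hs] at h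
    have : G.polyform (Function.update x k 0) = G.polyform x - D := by rw [hD]; ring
    rw [← hD, this] at h
    exact h
  have hmin : IsLocalMin (fun c : ℝ => lam α G * (1 - t + c ^ α * t) ^ ((r : ℝ) / α) -
      (G.polyform x - D + c * D)) 1 := by
    filter_upwards [lt_mem_nhds (zero_lt_one : (0 : ℝ) < 1)] with c hc
    have h := hnonneg c hc.le
    simp only [Real.one_rpow, one_mul, sub_add_cancel, mul_one]
    rw [hmax] at *
    linarith
  have hder : HasDerivAt (fun c : ℝ => lam α G * (1 - t + c ^ α * t) ^ ((r : ℝ) / α) -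
      (G.polyform x - D + c * D)) (lam α G * (r * t) - D) 1 := by
    have h1 : HasDerivAt (fun c : ℝ => c ^ α) (α * 1 ^ (α - 1)) 1 :=
      Real.hasDerivAt_rpow_const (Or.inr hα)
    have h2 := ((h1.mul_const t).const_add (1 - t)).rpow_const (p := (r : ℝ) / α)
      (Or.inl (by simp))
    have h3 := (h2.const_mul (lam α G)).sub
      (((hasDerivAt_id (1 : ℝ)).mul_const D).const_add (G.polyform x - D))
    refine h3.congr_deriv ?_
    simp only [Real.one_rpow, one_mul, sub_add_cancel, mul_one]
    field_simp
  have h0 := hmin.hasDerivAt_eq_zero hder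
  have : G.polyform (Function.update x k 0) = G.polyform x - D := by rw [hD]; ring
  rw [this, hmax]
  linarith

theorem exists_mem_lamP_eq (P : ∀ n, Set (HGraph r n)) (hne : (P n).Nonempty) (α : ℝ) :
    ∃ G ∈ P n, lamP α P n = lam α G := by
  have hfin : {y : ℝ | ∃ G ∈ P n, y = lam α G}.Finite := by
    refine ((Set.toFinite (P n)).image (lam α)).subset ?_
    rintro _ ⟨G, hG, rfl⟩
    exact ⟨G, hG, rfl⟩
  obtain ⟨G, hG⟩ := hne
  have hne' : {y : ℝ | ∃ G ∈ P n, y = lam α G}.Nonempty := ⟨_, G, hG, rfl⟩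
  exact hne'.csSup_mem hfin

theorem lam_le_lamP (P : ∀ n, Set (HGraph r n)) {G : HGraph r n} (hG : G ∈ P n) (α : ℝ) :
    lam α G ≤ lamP α P n := by
  have hfin : {y : ℝ | ∃ G ∈ P n, y = lam α G}.Finite := by
    refine ((Set.toFinite (P n)).image (lam α)).subset ?_
    rintro _ ⟨G, hG, rfl⟩
    exact ⟨G, hG, rfl⟩
  exact le_csSup hfin.bddAbove ⟨G, hG, rfl⟩

theorem lamP_nonneg (P : ∀ n, Set (HGraph r n)) (hne : (P (n + 1)).Nonempty) {α : ℝ}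
    (hα : 0 < α) : 0 ≤ lamP α P (n + 1) := by
  obtain ⟨G, hG⟩ := hne
  exact (G.lam_nonneg hα).trans (lam_le_lamP P hG α)

theorem one_sub_rpow_mul_le {p s t : ℝ} (hr : r ≠ 0) (hp : p ≤ r) (ht : 0 ≤ t)
    (hts : t ≤ s) (hs : r * s < 1) :
    (1 - t) ^ p * (1 - r * s) ≤ (1 - s) ^ p * (1 - r * t) := by
  have hr1 : (1 : ℝ) ≤ r := by exact_mod_cast Nat.one_le_iff_ne_zero.2 hr
  have hs1 : s < 1 := by nlinarith
  have h1t : 0 < 1 - t := by linarith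
  have h1s : 0 < 1 - s := by linarith
  have hrt : 0 < 1 - r * t := by nlinarith
  set q := (1 - s) / (1 - t) with hq
  have hq0 : 0 < q := div_pos h1s h1t
  have hq1 : q ≤ 1 := (div_le_one h1t).2 (by linarith)
  have hqp : (1 - s) ^ p = q ^ p * (1 - t) ^ p := by
    rw [← Real.mul_rpow hq0.le h1t.le, hq, div_mul_cancel₀ _ h1t.ne']
  have hpr : q ^ r ≤ q ^ p := by
    rw [← Real.rpow_natCast]
    exact Real.rpow_le_rpow_of_exponent_ge hq0 hq1 hp
  have hbern : 1 + r * (q - 1) ≤ q ^ r := by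
    have := one_add_mul_le_pow (a := q - 1) (by linarith) r
    simpa using this
  have hqt : q - 1 = -((s - t) / (1 - t)) := by
    rw [hq]
    field_simp
    ring
  have hkey : 1 - r * s ≤ q ^ p * (1 - r * t) := by
    have h1 : (1 + r * (q - 1)) * (1 - r * t) ≤ q ^ p * (1 - r * t) :=
      mul_le_mul_of_nonneg_right (hbern.trans hpr) hrt.le
    have h2 : (s - t) / (1 - t) * (1 - r * t) ≤ s - t := by
      rw [div_mul_eq_mul_div, div_le_iff₀ h1t]
      exact mul_le_mul_of_nonneg_left (by nlinarith) (by linarith)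
    rw [hqt] at h1
    nlinarith
  rw [hqp]
  have := mul_le_mul_of_nonneg_left hkey (Real.rpow_nonneg h1t.le p)
  linarith

theorem lamP_succ_mul_le (P : ∀ n, Set (HGraph r n)) (hher : Hereditary P)
    (hne : ∀ n, (P n).Nonempty) (hr : r ≠ 0) (hn : r ≤ n) {α : ℝ} (hα : 1 ≤ α) :
    lamP α P (n + 1) * ((n : ℝ) + 1) ^ ((r : ℝ) / α) * (n + 1 - r) ≤
      lamP α P n * (n : ℝ) ^ ((r : ℝ) / α) * (n + 1) := by
  have hα0 : 0 < α := by linarith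
  obtain ⟨m, rfl⟩ : ∃ m, n = m + 1 := Nat.exists_eq_succ_of_ne_zero (by omega)
  obtain ⟨G, hG, hGl⟩ := exists_mem_lamP_eq P (hne (m + 1 + 1)) α
  obtain ⟨x, hx, hsum, hmax⟩ := G.exists_nonneg_polyform_eq_lam hα0
  obtain ⟨k, -, hk⟩ := Finset.exists_min_image Finset.univ (fun i => x i ^ α)
    Finset.univ_nonempty
  set N : ℝ := ((m + 1 : ℕ) : ℝ) with hN
  set t := x k ^ α with ht
  have ht0 : 0 ≤ t := Real.rpow_nonneg (hx k) _
  have hNr : (r : ℝ) ≤ N := Nat.cast_le.2 hn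
  have hN0 : 0 < N := by rw [hN]; positivity
  have hts : t ≤ 1 / (N + 1) := by
    have h := Finset.card_nsmul_le_sum Finset.univ (fun i => x i ^ α) t
      fun i hi => hk i hi
    rw [hsum, Finset.card_univ, Fintype.card_fin, nsmul_eq_mul] at h
    rw [le_div_iff₀ (by linarith)]
    push_cast at h hN
    rw [hN]
    linarith
  have hdel := G.polyform_update_zero_eq hr hα hx hsum hmax k
  rw [← polyform_induce_succAbove, ← ht, ← hGl] at hdel
  have hle := (G.induce k.succAboveEmb).polyform_le_lam_mul hr hα0
    (x := fun i => x (k.succAbove i)) fun i => hx _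
  have hsum' : ∑ i, x (k.succAbove i) ^ α = 1 - t := by
    rw [Fin.sum_univ_succAbove _ k] at hsum
    linarith
  rw [hdel, hsum'] at hle
  have ht1 : t < 1 := lt_of_le_of_lt hts (by rw [div_lt_one] <;> linarith)
  have hpow0 : 0 ≤ (1 - t) ^ ((r : ℝ) / α) := Real.rpow_nonneg (by linarith) _
  have hle2 : lamP α P (m + 1 + 1) * (1 - r * t) ≤
      lamP α P (m + 1) * (1 - t) ^ ((r : ℝ) / α) :=
    hle.trans (mul_le_mul_of_nonneg_right
      (lam_le_lamP P (hher _ _ _ G hG) α) hpow0)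
  have hrs : r * (1 / (N + 1)) < 1 := by
    rw [mul_one_div, div_lt_one] <;> linarith
  have hrt : 0 < 1 - r * t := by
    have := mul_le_mul_of_nonneg_left hts (Nat.cast_nonneg r)
    linarith
  have hcmp := one_sub_rpow_mul_le (p := (r : ℝ) / α) hr
    (div_le_self (Nat.cast_nonneg r) hα) ht0 hts hrs
  have ha := lamP_nonneg P (hne (m + 1)) hα0
  have hmain : lamP α P (m + 1 + 1) * (1 - r * (1 / (N + 1))) ≤
      lamP α P (m + 1) * (1 - 1 / (N + 1)) ^ ((r : ℝ) / α) := by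
    refine le_of_mul_le_mul_right ?_ hrt
    calc lamP α P (m + 1 + 1) * (1 - r * (1 / (N + 1))) * (1 - r * t)
        = lamP α P (m + 1 + 1) * (1 - r * t) * (1 - r * (1 / (N + 1))) := by ring
      _ ≤ lamP α P (m + 1) * (1 - t) ^ ((r : ℝ) / α) * (1 - r * (1 / (N + 1))) :=
          mul_le_mul_of_nonneg_right hle2 (by linarith)
      _ = lamP α P (m + 1) * ((1 - t) ^ ((r : ℝ) / α) * (1 - r * (1 / (N + 1)))) := by ring
      _ ≤ lamP α P (m + 1) * ((1 - 1 / (N + 1)) ^ ((r : ℝ) / α) * (1 - r * t)) :=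
          mul_le_mul_of_nonneg_left hcmp ha
      _ = _ := by ring
  have hN1 : 0 < N + 1 := by linarith
  have e1 : 1 - 1 / (N + 1) = N / (N + 1) := by field_simp; ring
  have e2 : 1 - r * (1 / (N + 1)) = (N + 1 - r) / (N + 1) := by field_simp
  have hq : 0 < (N + 1) ^ ((r : ℝ) / α) := Real.rpow_pos_of_pos hN1 _
  rw [e1, e2, Real.div_rpow hN0.le hN1.le, mul_div_assoc', mul_div_assoc',
    div_le_div_iff₀ hN1 hq] at hmain
  linarith

theorem tendsto_descFactorial_div_pow (r : ℕ) :
    Filter.Tendsto (fun n : ℕ => (n.descFactorial r : ℝ) / (n : ℝ) ^ r)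
      Filter.atTop (nhds 1) := by
  induction r with
  | zero => simp
  | succ r ih =>
    have h : Filter.Tendsto (fun n : ℕ => 1 - (r : ℝ) / n) Filter.atTop (nhds (1 - 0)) :=
      tendsto_const_nhds.sub (tendsto_const_div_atTop_nhds_zero_nat _)
    have := h.mul ih
    rw [sub_zero, mul_one] at this
    refine this.congr' ?_
    filter_upwards [Filter.eventually_ge_atTop (r + 1)] with n hn
    have hn0 : (n : ℝ) ≠ 0 := by
      have : n ≠ 0 := by omega
      exact_mod_cast this
    rw [Nat.descFactorial_succ, Nat.cast_mul, Nat.cast_sub (by omega), pow_succ]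
    field_simp

theorem exists_tendsto_lamP (P : ∀ n, Set (HGraph r n)) (hher : Hereditary P)
    (hne : ∀ n, (P n).Nonempty) (hr : r ≠ 0) {α : ℝ} (hα : 1 ≤ α) :
    ∃ L : ℝ, Filter.Tendsto (fun n : ℕ => lamP α P n * (n : ℝ) ^ ((r : ℝ) / α - r))
      Filter.atTop (nhds L) := by
  set b : ℕ → ℝ := fun n => lamP α P n * (n : ℝ) ^ ((r : ℝ) / α) / n.descFactorial r with hb
  have hpos : ∀ n, r ≤ n → (0 : ℝ) < n.descFactorial r := fun n hn => by
    exact_mod_cast Nat.descFactorial_pos.2 hn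
  have hanti : Antitone fun n => b (n + r) := by
    refine antitone_nat_of_succ_le fun m => ?_
    have hn : r ≤ m + r := Nat.le_add_left _ _
    have e : m + 1 + r = m + r + 1 := by omega
    simp only [e]
    set n := m + r
    have hrec := lamP_succ_mul_le P hher hne hr hn hα
    have hd : ((n : ℝ) + 1 - r) * (n + 1).descFactorial r = (n + 1) * n.descFactorial r := by
      have := Nat.succ_descFactorial n r
      have h2 : ((n + 1 - r : ℕ) : ℝ) = (n : ℝ) + 1 - r := by
        rw [Nat.cast_sub (by omega)]
        push_cast
        ring
      rw [← h2]
      exact_mod_cast this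
    have hnr : (0 : ℝ) < (n : ℝ) + 1 - r := by
      have : (r : ℝ) ≤ n := by exact_mod_cast hn
      linarith
    rw [hb]
    simp only
    rw [div_le_div_iff₀ (hpos _ (by omega)) (hpos _ hn)]
    refine le_of_mul_le_mul_right ?_ hnr
    push_cast
    calc lamP α P (n + 1) * ((n : ℝ) + 1) ^ ((r : ℝ) / α) * n.descFactorial r * (n + 1 - r)
        = lamP α P (n + 1) * ((n : ℝ) + 1) ^ ((r : ℝ) / α) * (n + 1 - r) *
            n.descFactorial r := by ring
      _ ≤ lamP α P n * (n : ℝ) ^ ((r : ℝ) / α) * (n + 1) * n.descFactorial r :=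
          mul_le_mul_of_nonneg_right hrec (hpos _ hn).le
      _ = lamP α P n * (n : ℝ) ^ ((r : ℝ) / α) * ((n + 1) * n.descFactorial r) := by ring
      _ = _ := by rw [← hd]; ring
  have hbdd : BddBelow (Set.range fun n => b (n + r)) := by
    refine ⟨0, ?_⟩
    rintro _ ⟨m, rfl⟩
    obtain ⟨j, hj⟩ : ∃ j, m + r = j + 1 := Nat.exists_eq_succ_of_ne_zero (by omega)
    simp only [hb, hj]
    exact div_nonneg (mul_nonneg (lamP_nonneg P (hne _) (by linarith))
      (Real.rpow_nonneg (Nat.cast_nonneg _) _)) (Nat.cast_nonneg _)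
  have hlim := (Filter.tendsto_add_atTop_iff_nat r).1 (tendsto_atTop_ciInf hanti hbdd)
  refine ⟨_, (hlim.mul (tendsto_descFactorial_div_pow r)).congr' ?_⟩
  filter_upwards [Filter.eventually_ge_atTop r] with n hn
  have hn0 : (0 : ℝ) < n := by
    have : 0 < n := by omega
    exact_mod_cast this
  have := hpos n hn
  rw [Real.rpow_sub hn0, Real.rpow_natCast]
  simp only [hb]
  field_simp

theorem lamP_mul_rpow_le (P : ∀ n, Set (HGraph r n)) (hne : (P (n + 1)).Nonempty)
    (hr : r ≠ 0) {α β : ℝ} (hα : 0 < α) (hαβ : α ≤ β) :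
    lamP β P (n + 1) * ((n + 1 : ℕ) : ℝ) ^ ((r : ℝ) / β - r) ≤
      lamP α P (n + 1) * ((n + 1 : ℕ) : ℝ) ^ ((r : ℝ) / α - r) := by
  have hβ : 0 < β := hα.trans_le hαβ
  obtain ⟨G, hG, hGl⟩ := exists_mem_lamP_eq P hne β
  obtain ⟨x, hx, hsum, hmax⟩ := G.exists_nonneg_polyform_eq_lam hβ
  set N : ℝ := ((n + 1 : ℕ) : ℝ) with hN
  have hN0 : 0 < N := by rw [hN]; positivity
  have hS0 : 0 ≤ ∑ i, x i ^ α := Finset.sum_nonneg fun i _ => Real.rpow_nonneg (hx i) _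
  have hpm := Real.rpow_sum_le_const_mul_sum_rpow_of_nonneg Finset.univ
    (f := fun i => x i ^ α) (p := β / α) ((one_le_div hα).2 hαβ)
    fun i _ => Real.rpow_nonneg (hx i) _
  have hpow : ∀ i, (x i ^ α) ^ (β / α) = x i ^ β := fun i => by
    rw [← Real.rpow_mul (hx i), mul_div_cancel₀ _ hα.ne']
  simp only [hpow] at hpm
  rw [hsum, mul_one, Finset.card_univ, Fintype.card_fin, ← hN] at hpm
  have hS : (∑ i, x i ^ α) ^ ((r : ℝ) / α) ≤ N ^ ((r : ℝ) / α - r / β) := by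
    have h := Real.rpow_le_rpow (Real.rpow_nonneg hS0 _) hpm
      (div_nonneg (Nat.cast_nonneg r) hβ.le)
    rw [← Real.rpow_mul hS0, ← Real.rpow_mul hN0.le] at h
    have e1 : β / α * ((r : ℝ) / β) = r / α := by field_simp
    have e2 : (β / α - 1) * ((r : ℝ) / β) = r / α - r / β := by rw [sub_mul, e1, one_mul]
    rwa [e1, e2] at h
  have h1 : lamP β P (n + 1) ≤ lamP α P (n + 1) * N ^ ((r : ℝ) / α - r / β) := by
    rw [hGl, ← hmax]
    refine (G.polyform_le_lam_mul hr hα hx).trans ?_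
    exact mul_le_mul (lam_le_lamP P hG α) hS (Real.rpow_nonneg hS0 _)
      (lamP_nonneg P ⟨G, hG⟩ hα)
  calc lamP β P (n + 1) * N ^ ((r : ℝ) / β - r)
      ≤ lamP α P (n + 1) * N ^ ((r : ℝ) / α - r / β) * N ^ ((r : ℝ) / β - r) :=
        mul_le_mul_of_nonneg_right h1 (Real.rpow_nonneg hN0.le _)
    _ = lamP α P (n + 1) * N ^ ((r : ℝ) / α - r) := by
        rw [mul_assoc, ← Real.rpow_add hN0]
        congr 2
        ring

end HGraph

/-- Theorem 2: for a hereditary property `P` of `r`-graphs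
(containing graphs of every order), `λ^(α)(P)` is nonincreasing in `α` on `[1, ∞)`. -/
theorem stmt10 {r : ℕ} (hr : 2 ≤ r)
    (P : ∀ n, Set (HGraph r n)) (hprop : IsProperty P) (hher : Hereditary P)
    (hne : ∀ n, (P n).Nonempty) (α β : ℝ) (hα : 1 ≤ α) (hαβ : α ≤ β) :
    ∃ Lα Lβ : ℝ,
      Filter.Tendsto (fun n : ℕ => lamP α P n * (n : ℝ) ^ ((r : ℝ) / α - r))
        Filter.atTop (nhds Lα) ∧
      Filter.Tendsto (fun n : ℕ => lamP β P n * (n : ℝ) ^ ((r : ℝ) / β - r))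
        Filter.atTop (nhds Lβ) ∧
      Lβ ≤ Lα := by
  obtain ⟨Lα, hLα⟩ := exists_tendsto_lamP P hher hne (by omega) hα
  obtain ⟨Lβ, hLβ⟩ := exists_tendsto_lamP P hher hne (by omega) (hα.trans hαβ)
  refine ⟨Lα, Lβ, hLα, hLβ, le_of_tendsto_of_tendsto hLβ hLα ?_⟩
  filter_upwards [Filter.eventually_ge_atTop 1] with n hn
  obtain ⟨m, rfl⟩ : ∃ m, n = m + 1 := Nat.exists_eq_succ_of_ne_zero (by omega)
  exact lamP_mul_rpow_le P (hne _) (by omega) (by linarith) hαβ
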